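/- Let r, s and n be integers satisfying 0 ≤ r < s < n, s^3 > n, and gcd(r, s) = 1. Then there exist at most 11 positive divisors of n that are congruent to r modulo s. -/

import Mathlib

/-- Pair weights, supported above the diagonal and of total weight `78`. For every set of indices,
the pairs `(i, j)` with `j` inside and `i` outside have total weight at most `26`. -/
def pairWeight : Fin 12 → Fin 12 → ℕ :=
  ![![0, 4, 0, 0, 0, 0, 0, 0, 0, 0, 0, 0],
    ![0, 0, 4, 3, 1, 3, 1, 0, 0, 0, 0, 0],
    ![0, 0, 0, 3, 1, 3, 1, 0, 0, 0, 0, 0],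
    ![0, 0, 0, 0, 2, 4, 2, 1, 0, 0, 0, 0],
    ![0, 0, 0, 0, 0, 2, 2, 1, 0, 0, 0, 0],
    ![0, 0, 0, 0, 0, 0, 4, 3, 2, 2, 2, 0],
    ![0, 0, 0, 0, 0, 0, 0, 3, 2, 2, 2, 0],
    ![0, 0, 0, 0, 0, 0, 0, 0, 2, 2, 2, 0],
    ![0, 0, 0, 0, 0, 0, 0, 0, 0, 2, 2, 0],
    ![0, 0, 0, 0, 0, 0, 0, 0, 0, 0, 2, 2],
    ![0, 0, 0, 0, 0, 0, 0, 0, 0, 0, 0, 4],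
    ![0, 0, 0, 0, 0, 0, 0, 0, 0, 0, 0, 0]]

theorem pairWeight_eq_zero {i j : Fin 12} (h : j ≤ i) : pairWeight i j = 0 := by
  revert i j; decide

theorem sum_pairWeight : ∑ i, ∑ j, pairWeight i j = 78 := by decide

theorem sum_pairWeight_rows_le : ∀ a b c d e f g h k l m n : Bool,
    (!a).toNat * (4 * b.toNat) +
    (!b).toNat * (4 * c.toNat + 3 * d.toNat + 1 * e.toNat + 3 * f.toNat + 1 * g.toNat) +
    (!c).toNat * (3 * d.toNat + 1 * e.toNat + 3 * f.toNat + 1 * g.toNat) +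
    (!d).toNat * (2 * e.toNat + 4 * f.toNat + 2 * g.toNat + 1 * h.toNat) +
    (!e).toNat * (2 * f.toNat + 2 * g.toNat + 1 * h.toNat) +
    (!f).toNat * (4 * g.toNat + 3 * h.toNat + 2 * k.toNat + 2 * l.toNat + 2 * m.toNat) +
    (!g).toNat * (3 * h.toNat + 2 * k.toNat + 2 * l.toNat + 2 * m.toNat) +
    (!h).toNat * (2 * k.toNat + 2 * l.toNat + 2 * m.toNat) +
    (!k).toNat * (2 * l.toNat + 2 * m.toNat) +
    (!l).toNat * (2 * m.toNat + 2 * n.toNat) +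
    (!m).toNat * (4 * n.toNat) ≤ 26 := by
  decide +kernel

theorem sum_pairWeight_cut_le (x : Fin 12 → Bool) :
    ∑ i, ∑ j, pairWeight i j * (x j && !x i).toNat ≤ 26 := by
  have hand (a b : Bool) : (a && b).toNat = b.toNat * a.toNat := by cases a <;> cases b <;> rfl
  have key := sum_pairWeight_rows_le (x 0) (x 1) (x 2) (x 3) (x 4) (x 5) (x 6) (x 7) (x 8) (x 9)
    (x 10) (x 11)
  simp only [hand, mul_left_comm (pairWeight _ _), ← Finset.mul_sum]
  simpa [Fin.sum_univ_ofNat, pairWeight, ← add_assoc] using key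

/-- The bound for cuts extends to natural number valued functions by slicing them into level
sets. -/
theorem sum_pairWeight_mul_sub_le (N : ℕ) (e : Fin 12 → ℕ) (he : ∀ i, e i ≤ N) :
    ∑ i, ∑ j, pairWeight i j * (e j - e i) ≤ 26 * N := by
  induction N generalizing e with
  | zero => simp [fun i => Nat.le_zero.mp (he i)]
  | succ N ih =>
    have hstep (i j : Fin 12) : e j - e i = (min (e j) N - min (e i) N) +
        (decide (N < e j) && !decide (N < e i)).toNat := by
      have := he i
      have := he j
      by_cases hi : N < e i <;> by_cases hj : N < e j <;> simp [hi, hj] <;> omega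
    simp only [hstep, mul_add, Finset.sum_add_distrib]
    have := ih (fun i => min (e i) N) fun i => min_le_right _ _
    have := sum_pairWeight_cut_le fun i => decide (N < e i)
    omega

theorem prod_div_gcd_pow_dvd {n : ℕ} (hn : n ≠ 0) {d : Fin 12 → ℕ} (hd : ∀ i, d i ∣ n) :
    ∏ i, ∏ j, (d j / Nat.gcd (d i) (d j)) ^ pairWeight i j ∣ n ^ 26 := by
  have hd0 (i) : d i ≠ 0 := ne_zero_of_dvd_ne_zero hn (hd i)
  have hq (i j) : d j / Nat.gcd (d i) (d j) ≠ 0 :=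
    (Nat.div_pos (Nat.gcd_le_right _ (Nat.pos_of_ne_zero (hd0 j)))
      (Nat.gcd_pos_of_pos_left _ (Nat.pos_of_ne_zero (hd0 i)))).ne'
  have hpow (i j) : (d j / Nat.gcd (d i) (d j)) ^ pairWeight i j ≠ 0 := pow_ne_zero _ (hq i j)
  have hprod (i) : ∏ j, (d j / Nat.gcd (d i) (d j)) ^ pairWeight i j ≠ 0 :=
    Finset.prod_ne_zero_iff.mpr fun j _ => hpow i j
  rw [← Nat.factorization_le_iff_dvd (Finset.prod_ne_zero_iff.mpr fun i _ => hprod i)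
    (pow_ne_zero _ hn)]
  intro p
  have key := sum_pairWeight_mul_sub_le (n.factorization p) (fun i => (d i).factorization p)
    fun i => (Nat.factorization_le_iff_dvd (hd0 i) hn).mpr (hd i) p
  rw [Nat.factorization_prod fun i _ => hprod i]
  simp only [Nat.factorization_prod fun j _ => hpow _ j, Nat.factorization_pow,
    Nat.factorization_div (Nat.gcd_dvd_right _ _), Nat.factorization_gcd (hd0 _) (hd0 _),
    Finsupp.coe_finsetSum, Finset.sum_apply, Finsupp.smul_apply, Finsupp.tsub_apply,
    Finsupp.inf_apply, smul_eq_mul]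
  refine le_of_eq_of_le (Finset.sum_congr rfl fun i _ => Finset.sum_congr rfl fun j _ => ?_) key
  congr 1
  change (d j).factorization p - min ((d i).factorization p) ((d j).factorization p) = _
  omega

/-- Two distinct numbers in the same residue class modulo `s`, coprime to `s`, are far apart
relative to their greatest common divisor. -/
theorem lt_div_gcd_of_modEq {a b s : ℕ} (ha : 0 < a) (hab : a < b) (hs : a ≡ b [MOD s])
    (hcop : Nat.Coprime a s) : s < b / Nat.gcd a b := by
  have hg : 0 < Nat.gcd a b := Nat.gcd_pos_of_pos_left _ ha
  have hdvd : s * Nat.gcd a b ∣ b - a :=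
    (hcop.coprime_dvd_left (Nat.gcd_dvd_left a b)).symm.mul_dvd_of_dvd_of_dvd
      ((Nat.modEq_iff_dvd' hab.le).mp hs)
      (Nat.dvd_sub (Nat.gcd_dvd_right a b) (Nat.gcd_dvd_left a b))
  have hle := Nat.le_of_dvd (Nat.sub_pos_of_lt hab) hdvd
  rw [← Nat.mul_lt_mul_right hg, Nat.div_mul_cancel (Nat.gcd_dvd_right a b)]
  omega

theorem card_le_eleven_of_modEq {n s : ℕ} (hn : n ≠ 0) (hs : n < s ^ 3) (S : Finset ℕ)
    (hdvd : ∀ d ∈ S, d ∣ n) (hcop : ∀ d ∈ S, Nat.Coprime d s)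
    (hmod : ∀ a ∈ S, ∀ b ∈ S, a ≡ b [MOD s]) : S.card ≤ 11 := by
  by_contra! hcard
  obtain ⟨T, hTS, hT⟩ := Finset.exists_subset_card_eq (show 12 ≤ S.card from hcard)
  set d := T.orderEmbOfFin hT
  have hdS (i) : d i ∈ S := hTS (T.orderEmbOfFin_mem hT i)
  have hle : s ^ 78 ≤ ∏ i, ∏ j, (d j / Nat.gcd (d i) (d j)) ^ pairWeight i j := by
    rw [← sum_pairWeight, ← Finset.prod_pow_eq_pow_sum]
    simp only [← Finset.prod_pow_eq_pow_sum]
    refine Finset.prod_le_prod' fun i _ => Finset.prod_le_prod' fun j _ => ?_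
    rcases le_or_gt j i with h | h
    · simp [pairWeight_eq_zero h]
    · exact Nat.pow_le_pow_left (lt_div_gcd_of_modEq
        (Nat.pos_of_dvd_of_pos (hdvd _ (hdS i)) (Nat.pos_of_ne_zero hn))
        (d.strictMono h) (hmod _ (hdS i) _ (hdS j)) (hcop _ (hdS i))).le _
  have hlt : n ^ 26 < s ^ 78 := by
    rw [show s ^ 78 = (s ^ 3) ^ 26 by ring]
    exact Nat.pow_lt_pow_left hs (by norm_num)
  exact absurd (hle.trans (Nat.le_of_dvd (pow_pos (Nat.pos_of_ne_zero hn) _)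
    (prod_div_gcd_pow_dvd hn fun i => hdvd _ (hdS i)))) hlt.not_ge

/-- Let `r, s, n` be integers with `0 ≤ r < s < n`, `s ^ 3 > n` and `gcd(r, s) = 1`. Then there
are at most 11 positive divisors of `n` congruent to `r` modulo `s`. -/
theorem stmt_1 (r s n : ℤ) (hr : 0 ≤ r) (hrs : r < s) (hsn : s < n)
    (hs3 : s ^ 3 > n) (hgcd : Int.gcd r s = 1) :
    (n.toNat.divisors.filter fun d : ℕ => ((d : ℤ) ≡ r [ZMOD s])).card ≤ 11 := by
  lift s to ℕ using hr.trans hrs.le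
  lift n to ℕ using by omega
  simp only [Int.toNat_natCast]
  refine card_le_eleven_of_modEq (n := n) (s := s) (by omega) (by exact_mod_cast hs3) _
    (fun d hd => Nat.dvd_of_mem_divisors (Finset.mem_filter.mp hd).1) (fun d hd => ?_)
    fun a ha b hb => Int.natCast_modEq_iff.mp
      ((Finset.mem_filter.mp ha).2.trans (Finset.mem_filter.mp hb).2.symm)
  have hd : ((d : ℤ) % s).gcd s = (r % s).gcd s := by rw [(Finset.mem_filter.mp hd).2]
  rwa [Int.gcd_emod, Int.gcd_emod, hgcd, Int.gcd_natCast_natCast] at hd
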